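/- Let n ≥ 1 be an integer and suppose < is a left-invariant linear order on G_n with 1 < b⁻¹·a. Then it is not the case that 1 < a, 1 < b, c < 1, and 1 < d all hold (Case 3 is impossible). -/

import Mathlib

/-- The four generators of the Kanenobu group `G n`. -/
inductive Gen : Type
  | a | b | c | d
  deriving DecidableEq

open FreeGroup in
/-- The four relators of the presentation of `G n`. -/
def kanenobuRels (n : ℕ) : Set (FreeGroup Gen) :=
  { ((of Gen.a)⁻¹ * of Gen.b) ^ (10 * n) * (of Gen.d)⁻¹ * (of Gen.a) ^ 2,
    ((of Gen.b)⁻¹) ^ 2 * of Gen.c * ((of Gen.b)⁻¹ * of Gen.a) ^ (10 * n),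
    ((of Gen.d)⁻¹ * of Gen.c) ^ (10 * n + 3) * (of Gen.c)⁻¹ * of Gen.b * ((of Gen.c)⁻¹) ^ 2,
    (of Gen.d) ^ 2 * (of Gen.a)⁻¹ * of Gen.d * ((of Gen.c)⁻¹ * of Gen.d) ^ (10 * n + 3) }

/-- The group `G n`, fundamental group of the double branched cover of `K_{-10n,10n+3}`. -/
abbrev G (n : ℕ) : Type := PresentedGroup (kanenobuRels n)

/-- The image of the generator `a` in `G n`. -/
def ga (n : ℕ) : G n := PresentedGroup.of Gen.a
/-- The image of the generator `b` in `G n`. -/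
def gb (n : ℕ) : G n := PresentedGroup.of Gen.b
/-- The image of the generator `c` in `G n`. -/
def gc (n : ℕ) : G n := PresentedGroup.of Gen.c
/-- The image of the generator `d` in `G n`. -/
def gd (n : ℕ) : G n := PresentedGroup.of Gen.d

/-- `lt` is a left-invariant linear (strict total) order on the group `G`. -/
def IsLeftInvariantLinearOrder (G : Type*) [Group G] (lt : G → G → Prop) : Prop :=
  IsStrictTotalOrder G lt ∧ ∀ f g h : G, lt g h → lt (f * g) (f * h)

theorem case3_aux {H : Type*} [Group H] (P : H → Prop) (h1 : ¬ P 1)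
    (hm : ∀ g h, P g → P h → P (g * h)) (N M : ℕ) (a b c d : H)
    (r1 : (a⁻¹ * b) ^ N * d⁻¹ * a ^ 2 = 1)
    (r2 : (b⁻¹) ^ 2 * c * (b⁻¹ * a) ^ N = 1)
    (r3 : (d⁻¹ * c) ^ M * c⁻¹ * b * (c⁻¹) ^ 2 = 1)
    (r4 : d ^ 2 * a⁻¹ * d * (c⁻¹ * d) ^ M = 1)
    (ha : P a) (hb : P b) (hc : P c⁻¹) (hd : P d) : False := by
  have e1 : (b⁻¹ * a) ^ N = d⁻¹ * a ^ 2 := by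
    have : (a⁻¹ * b) ^ N = ((b⁻¹ * a) ^ N)⁻¹ := by rw [← inv_pow]; congr 1; group
    rw [this, mul_assoc, inv_mul_eq_one] at r1
    exact r1
  have e2 : (b⁻¹ * a) ^ N = c⁻¹ * b ^ 2 := by
    rw [mul_eq_one_iff_inv_eq] at r2
    rw [← r2]; group
  have e3 : (c⁻¹ * d) ^ M = c⁻¹ * b * (c⁻¹) ^ 2 := by
    have : (d⁻¹ * c) ^ M = ((c⁻¹ * d) ^ M)⁻¹ := by rw [← inv_pow]; congr 1; group
    rw [this, mul_assoc, mul_assoc, inv_mul_eq_one] at r3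
    rw [r3]; group
  have e4 : (c⁻¹ * d) ^ M = d⁻¹ * a * (d⁻¹) ^ 2 := by
    rw [mul_eq_one_iff_inv_eq] at r4
    rw [← r4]; group
  have hu : c ^ 2 * b = d ^ 2 * a := by
    have k1 : c ^ 2 * b = ((c⁻¹ * d) ^ M)⁻¹ * (b⁻¹ * a) ^ N := by rw [e3, e2]; group
    have k2 : d ^ 2 * a = ((c⁻¹ * d) ^ M)⁻¹ * (b⁻¹ * a) ^ N := by rw [e4, e1]; group
    rw [k1, k2]
  have f1 : (c ^ 2 * b) * (b⁻¹ * a) * (c ^ 2 * b)⁻¹ = (d * d * c⁻¹ * c⁻¹)⁻¹ := by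
    calc _ = c ^ 2 * a * (c ^ 2 * b)⁻¹ := by group
      _ = _ := by rw [hu]; group
  have f2 : ((d * d * c⁻¹ * c⁻¹)⁻¹) ^ N = d * d * a * (c⁻¹ * b * c⁻¹ * c⁻¹) := by
    rw [← f1, conj_pow, e2]
    calc _ = (c ^ 2 * b) * (c⁻¹ * b * c⁻¹ * c⁻¹) := by group
      _ = _ := by rw [hu, pow_two d]
  have pw : P (d * d * c⁻¹ * c⁻¹) := hm _ _ (hm _ _ (hm _ _ hd hd) hc) hc
  have pu : P (((d * d * c⁻¹ * c⁻¹)⁻¹) ^ N) := by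
    rw [f2]
    exact hm _ _ (hm _ _ (hm _ _ hd hd) ha) (hm _ _ (hm _ _ (hm _ _ hc hb) hc) hc)
  have key : ∀ k : ℕ, P (((d * d * c⁻¹ * c⁻¹)⁻¹) ^ k) → False := by
    intro k
    induction k with
    | zero => intro h; exact h1 (by simpa only [pow_zero] using h)
    | succ k ih =>
      intro h
      apply ih
      have := hm _ _ h pw
      rwa [pow_succ, inv_mul_cancel_right] at this
  exact key N pu

/-- Case 3 (`a,b,d` positive, `c` negative) is impossible. -/
theorem case3_impossible (n : ℕ) (hn : 1 ≤ n) (lt : G n → G n → Prop)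
    (hlt : IsLeftInvariantLinearOrder (G n) lt) (hba : lt 1 ((gb n)⁻¹ * ga n)) :
    ¬ (lt 1 (ga n) ∧ lt 1 (gb n) ∧ lt (gc n) 1 ∧ lt 1 (gd n)) := by
  rintro ⟨ha, hb, hc, hd⟩
  obtain ⟨ho, hl⟩ := hlt
  have rel : ∀ w ∈ kanenobuRels n, PresentedGroup.mk (kanenobuRels n) w = 1 :=
    fun w hw => PresentedGroup.one_of_mem hw
  refine case3_aux (fun g => lt 1 g) (irrefl_of lt 1) ?_ (10 * n) (10 * n + 3)
    (ga n) (gb n) (gc n) (gd n) ?_ ?_ ?_ ?_ ha hb ?_ hd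
  · intro g h hg hh
    have := hl g 1 h hh
    rw [mul_one] at this
    exact trans_of lt hg this
  · exact rel _ (Or.inl rfl)
  · exact rel _ (Or.inr (Or.inl rfl))
  · exact rel _ (Or.inr (Or.inr (Or.inl rfl)))
  · exact rel _ (Or.inr (Or.inr (Or.inr rfl)))
  · have := hl (gc n)⁻¹ _ _ hc
    rwa [inv_mul_cancel, mul_one] at this
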